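/- Assume β_{m−1} ∈ A, β_m ∈ A_𝔎 with ord(det β_m) = r, det D_{m,0} ≠ 0, det Z1 ≠ 0, and det Z2 ≠ 0, and define the dPI iterates β_{m+1}, β_{m+2}, β_{m+3}. Then det β_{m+3} ≠ 0 with ord(det β_{m+3}) = r if and only if det Z3 ≠ 0, where Z3 := D_{m,0} − (m+1)·Z1⁻¹ + (m+2)·Z2⁻¹. Equivalently, the coefficient of ε^j in det β_{m+3} vanishes for j < r, and the coefficient of ε^r is nonzero if and only if det Z3 ≠ 0. -/

import Mathlib

open Matrix

noncomputable section

/-- The field `ℂ((ε))` of formal Laurent series over `ℂ`. -/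
abbrev LS : Type := LaurentSeries ℂ

/-- Index type for `N × N` matrices in `2 × 2` block form, `N = r + s` with `s = N - r`. -/
abbrev Idx (r s : ℕ) : Type := Fin r ⊕ Fin s

/-- The complex matrix of coefficients of `ε^k` of a matrix of Laurent series. -/
def coeffM {r s : ℕ} (M : Matrix (Idx r s) (Idx r s) LS) (k : ℤ) :
    Matrix (Idx r s) (Idx r s) ℂ :=
  Matrix.of fun i j => (M i j).coeff k

/-- `M ∈ A`: every entry of `M` is a power series (no negative coefficients). -/
def memA {r s : ℕ} (M : Matrix (Idx r s) (Idx r s) LS) : Prop :=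
  ∀ i j, ∀ k : ℤ, k < 0 → (M i j).coeff k = 0

/-- `X ∈ 𝔎`: complex matrices whose first `r` rows vanish. -/
def memK {r s : ℕ} (X : Matrix (Idx r s) (Idx r s) ℂ) : Prop :=
  ∀ (i : Fin r) (j : Idx r s), X (Sum.inl i) j = 0

/-- `X ∈ 𝔏`: complex matrices whose last `N - r` columns vanish. -/
def memL {r s : ℕ} (X : Matrix (Idx r s) (Idx r s) ℂ) : Prop :=
  ∀ (i : Idx r s) (j : Fin s), X i (Sum.inr j) = 0

/-- `M ∈ A_𝔎`: `M ∈ A` and `M|_{ε=0} ∈ 𝔎`. -/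
def memAK {r s : ℕ} (M : Matrix (Idx r s) (Idx r s) LS) : Prop :=
  memA M ∧ memK (coeffM M 0)

/-- `M ∈ A_𝔏`: `M ∈ A` and `M|_{ε=0} ∈ 𝔏`. -/
def memAL {r s : ℕ} (M : Matrix (Idx r s) (Idx r s) LS) : Prop :=
  memA M ∧ memL (coeffM M 0)

/-- The Laurent series `ε`. -/
def eps : LS := HahnSeries.single (1 : ℤ) (1 : ℂ)

/-- A constant complex matrix viewed as a matrix of Laurent series. -/
def constM {r s : ℕ} (X : Matrix (Idx r s) (Idx r s) ℂ) :
    Matrix (Idx r s) (Idx r s) LS :=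
  X.map (algebraMap ℂ LS)

/-- `D_{M,k}` : the `(2,2)` block (size `(N−r) × (N−r)`) of the `ε^k`-coefficient. -/
def Dblk {r s : ℕ} (M : Matrix (Idx r s) (Idx r s) LS) (k : ℤ) : Matrix (Fin s) (Fin s) ℂ :=
  (coeffM M k).toBlocks₂₂

/-- `C_{M,k}` : the `(2,1)` block (size `(N−r) × r`) of the `ε^k`-coefficient. -/
def Cblk {r s : ℕ} (M : Matrix (Idx r s) (Idx r s) LS) (k : ℤ) : Matrix (Fin s) (Fin r) ℂ :=
  (coeffM M k).toBlocks₂₁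

/-- `B_{M,k}` : the `(1,2)` block (size `r × (N−r)`) of the `ε^k`-coefficient. -/
def Bblk {r s : ℕ} (M : Matrix (Idx r s) (Idx r s) LS) (k : ℤ) : Matrix (Fin r) (Fin s) ℂ :=
  (coeffM M k).toBlocks₁₂

/-- `A_{M,k}` : the `(1,1)` block (size `r × r`) of the `ε^k`-coefficient. -/
def Ablk {r s : ℕ} (M : Matrix (Idx r s) (Idx r s) LS) (k : ℤ) : Matrix (Fin r) (Fin r) ℂ :=
  (coeffM M k).toBlocks₁₁

/-- The leading Schur complement `S₁ = A_{m,1} − B_{m,1}·D_{m,0}⁻¹·C_{m,0}` of `β_m`. -/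
def S1 {r s : ℕ} (βm : Matrix (Idx r s) (Idx r s) LS) : Matrix (Fin r) (Fin r) ℂ :=
  Ablk βm 1 - Bblk βm 1 * (Dblk βm 0)⁻¹ * Cblk βm 0

/-- `Z₁ := m·D_{m,0}⁻¹ − D_{m−1,0} − D_{m,0} − α₂₂ − D_{m,0}⁻¹·C_{m,0}·(B_{m−1,0} + α₁₂)`. -/
def Z1 {r s : ℕ} (m : ℕ) (βprev βm : Matrix (Idx r s) (Idx r s) LS)
    (α : Matrix (Idx r s) (Idx r s) ℂ) : Matrix (Fin s) (Fin s) ℂ :=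
  (m : ℂ) • (Dblk βm 0)⁻¹ - Dblk βprev 0 - Dblk βm 0 - α.toBlocks₂₂
    - (Dblk βm 0)⁻¹ * Cblk βm 0 * (Bblk βprev 0 + α.toBlocks₁₂)

/-- `Z₂ := (m+1)·Z₁⁻¹ + D_{m,0}⁻¹·C_{m,0}·B_{m−1,0} − m·D_{m,0}⁻¹ + D_{m−1,0}`. -/
def Z2 {r s : ℕ} (m : ℕ) (βprev βm : Matrix (Idx r s) (Idx r s) LS)
    (α : Matrix (Idx r s) (Idx r s) ℂ) : Matrix (Fin s) (Fin s) ℂ :=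
  ((m : ℂ) + 1) • (Z1 m βprev βm α)⁻¹ + (Dblk βm 0)⁻¹ * Cblk βm 0 * Bblk βprev 0
    - (m : ℂ) • (Dblk βm 0)⁻¹ + Dblk βprev 0

/-- `Z₃ := D_{m,0} − (m+1)·Z₁⁻¹ + (m+2)·Z₂⁻¹`. -/
def Z3 {r s : ℕ} (m : ℕ) (βprev βm : Matrix (Idx r s) (Idx r s) LS)
    (α : Matrix (Idx r s) (Idx r s) ℂ) : Matrix (Fin s) (Fin s) ℂ :=
  Dblk βm 0 - ((m : ℂ) + 1) • (Z1 m βprev βm α)⁻¹ + ((m : ℂ) + 2) • (Z2 m βprev βm α)⁻¹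

section AbsLemma

lemma fromBlocks_sub' {r s : ℕ} (A A' : Matrix (Fin r) (Fin r) ℂ) (B B' : Matrix (Fin r) (Fin s) ℂ)
    (C C' : Matrix (Fin s) (Fin r) ℂ) (D D' : Matrix (Fin s) (Fin s) ℂ) :
    Matrix.fromBlocks A B C D - Matrix.fromBlocks A' B' C' D' =
      Matrix.fromBlocks (A - A') (B - B') (C - C') (D - D') := by
  ext i j
  rcases i with i | i <;> rcases j with j | j <;> simp

lemma abs_core {r s : ℕ} {R K : Type*} [CommRing R] [Field K] (φ : R →+* K) (ev : R →+* ℂ)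
    (hloc : ∀ x, ev x ≠ 0 → IsUnit x) (e : R) (he : φ e ≠ 0) (he0 : ev e = 0)
    (m : ℕ) (hm : 2 ≤ m)
    (U P a : Matrix (Fin r ⊕ Fin s) (Fin r ⊕ Fin s) R)
    (E : Matrix (Fin r ⊕ Fin s) (Fin r ⊕ Fin s) R)
    (hE : E = Matrix.fromBlocks (e • (1 : Matrix (Fin r) (Fin r) R)) 0 0 1)
    (A : Matrix (Fin r) (Fin r) ℂ) (B : Matrix (Fin r) (Fin s) ℂ)
    (C : Matrix (Fin s) (Fin r) ℂ) (D : Matrix (Fin s) (Fin s) ℂ)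
    (hU : ev.mapMatrix U = Matrix.fromBlocks A B C D) (hUd : ev U.det ≠ 0)
    (hD : D.det ≠ 0)
    (P11 : Matrix (Fin r) (Fin r) ℂ) (P12 : Matrix (Fin r) (Fin s) ℂ)
    (P21 : Matrix (Fin s) (Fin r) ℂ) (P22 : Matrix (Fin s) (Fin s) ℂ)
    (hP : ev.mapMatrix P = Matrix.fromBlocks P11 P12 P21 P22)
    (a11 : Matrix (Fin r) (Fin r) ℂ) (a12 : Matrix (Fin r) (Fin s) ℂ)
    (a21 : Matrix (Fin s) (Fin r) ℂ) (a22 : Matrix (Fin s) (Fin s) ℂ)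
    (ha : ev.mapMatrix a = Matrix.fromBlocks a11 a12 a21 a22)
    (ζ1 ζ2 ζ3 : Matrix (Fin s) (Fin s) ℂ)
    (hz1 : ζ1 = (m : ℂ) • D⁻¹ - P22 - D - a22 - D⁻¹ * C * (P12 + a12))
    (hz2 : ζ2 = ((m : ℂ) + 1) • ζ1⁻¹ + D⁻¹ * C * P12 - (m : ℂ) • D⁻¹ + P22)
    (hz3 : ζ3 = D - ((m : ℂ) + 1) • ζ1⁻¹ + ((m : ℂ) + 2) • ζ2⁻¹)
    (hZ1 : ζ1.det ≠ 0) (hZ2 : ζ2.det ≠ 0)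
    (β1 β2 β3 : Matrix (Fin r ⊕ Fin s) (Fin r ⊕ Fin s) K)
    (h1 : β1 = (m : K) • (φ.mapMatrix (E * U))⁻¹ - φ.mapMatrix P - φ.mapMatrix (E * U)
      - φ.mapMatrix a)
    (h2 : β2 = ((m : K) + 1) • β1⁻¹ - φ.mapMatrix (E * U) - β1 - φ.mapMatrix a)
    (h3 : β3 = ((m : K) + 2) • β2⁻¹ - β1 - β2 - φ.mapMatrix a) :
    ∃ T : Matrix (Fin r ⊕ Fin s) (Fin r ⊕ Fin s) R,
      β3 = φ.mapMatrix (E * T) ∧ (ev T.det ≠ 0 ↔ ζ3.det ≠ 0) := by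
  have hmC : (m : ℂ) ≠ 0 := by
    have : m ≠ 0 := by omega
    exact_mod_cast this
  -- general facts
  have φs : ∀ (c : R) (M : Matrix (Fin r ⊕ Fin s) (Fin r ⊕ Fin s) R),
      φ.mapMatrix (c • M) = φ c • φ.mapMatrix M := by
    intro c M; ext i j; simp
  have es : ∀ (c : R) (M : Matrix (Fin r ⊕ Fin s) (Fin r ⊕ Fin s) R),
      ev.mapMatrix (c • M) = ev c • ev.mapMatrix M := by
    intro c M; ext i j; simp
  have hinvU : ∀ M : Matrix (Fin r ⊕ Fin s) (Fin r ⊕ Fin s) R, (ev.mapMatrix M).det ≠ 0 →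
      IsUnit M.det := by
    intro M h; apply hloc; rwa [RingHom.map_det]
  have φinv : ∀ M : Matrix (Fin r ⊕ Fin s) (Fin r ⊕ Fin s) R, IsUnit M.det →
      (φ.mapMatrix M)⁻¹ = φ.mapMatrix M⁻¹ := by
    intro M h
    apply Matrix.inv_eq_right_inv
    rw [← map_mul, Matrix.mul_nonsing_inv _ h, map_one]
  have einv : ∀ M : Matrix (Fin r ⊕ Fin s) (Fin r ⊕ Fin s) R, IsUnit M.det →
      ∀ N, ev.mapMatrix M * N = 1 → ev.mapMatrix M⁻¹ = N := by
    intro M h N hN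
    have h2 : ev.mapMatrix M⁻¹ * ev.mapMatrix M = 1 := by
      rw [← map_mul, Matrix.nonsing_inv_mul _ h, map_one]
    calc ev.mapMatrix M⁻¹ = ev.mapMatrix M⁻¹ * (ev.mapMatrix M * N) := by rw [hN, mul_one]
      _ = N := by rw [← mul_assoc, h2, one_mul]
  have hEdet : IsUnit (φ.mapMatrix E).det := by
    rw [← RingHom.map_det, hE, Matrix.det_fromBlocks_zero₂₁]
    simp [he]
  have hE0 : ev.mapMatrix E = Matrix.fromBlocks 0 0 0 1 := by
    rw [hE]; ext i j
    rcases i with i | i <;> rcases j with j | j <;> simp [he0, Matrix.one_apply, apply_ite ev]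
  set Ek := φ.mapMatrix E with hEk
  set G := D⁻¹ * C with hG
  have hDu : IsUnit D.det := isUnit_iff_ne_zero.mpr hD
  have hDG : D * G = C := by rw [hG, Matrix.mul_nonsing_inv_cancel_left _ _ hDu]
  set S := A - B * G with hS
  set L : Matrix (Fin r ⊕ Fin s) (Fin r ⊕ Fin s) ℂ := Matrix.fromBlocks 1 0 (-G) 1 with hL
  set L' : Matrix (Fin r ⊕ Fin s) (Fin r ⊕ Fin s) ℂ := Matrix.fromBlocks 1 0 G 1 with hL'
  have hLL' : L * L' = 1 := by
    rw [hL, hL', Matrix.fromBlocks_multiply]; simp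
  have hL'L : L' * L = 1 := by
    rw [hL, hL', Matrix.fromBlocks_multiply]; simp
  have hLdet : L.det = 1 := by rw [hL, Matrix.det_fromBlocks_zero₁₂]; simp
  have hUL : ev.mapMatrix U * L = Matrix.fromBlocks S B 0 D := by
    rw [hU, hL, Matrix.fromBlocks_multiply]; simp [hDG, hS, sub_eq_add_neg]
  have hSdet : S.det ≠ 0 := by
    have := congrArg Matrix.det hUL
    rw [Matrix.det_mul, hLdet, mul_one, Matrix.det_fromBlocks_zero₂₁, ← RingHom.map_det] at this
    intro h; rw [h, zero_mul] at this; exact hUd this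
  have hSu : IsUnit S.det := isUnit_iff_ne_zero.mpr hSdet
  have hUu : IsUnit U.det := hloc _ hUd
  have hV0 : ev.mapMatrix U⁻¹ = L * Matrix.fromBlocks S⁻¹ (-(S⁻¹ * B * D⁻¹)) 0 D⁻¹ := by
    apply einv _ hUu
    rw [← mul_assoc, hUL, Matrix.fromBlocks_multiply]
    simp [Matrix.mul_nonsing_inv _ hSu, Matrix.mul_nonsing_inv _ hDu, ← Matrix.mul_assoc]
  have hβm : (φ.mapMatrix (E * U))⁻¹ = φ.mapMatrix U⁻¹ * Ek⁻¹ := by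
    rw [map_mul, Matrix.mul_inv_rev, φinv _ hUu]
  have hEE : Ek * Ek⁻¹ = 1 := Matrix.mul_nonsing_inv _ hEdet
  -- W
  set W := (m : R) • U⁻¹ - (P + E * U + a) * E with hW
  have hβ1 : β1 = φ.mapMatrix W * Ek⁻¹ := by
    rw [h1, hβm, hW, map_sub, φs, map_mul _ _ E, map_add, map_add, sub_mul, mul_assoc _ _ Ek⁻¹,
      ← hEk, hEE, mul_one, map_natCast, Matrix.smul_mul]
    abel
  have key : ∀ (Q : Matrix (Fin r ⊕ Fin s) (Fin r ⊕ Fin s) R) (c : ℂ), c ≠ 0 →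
      ∀ X12 (ζ : Matrix (Fin s) (Fin s) ℂ), ζ.det ≠ 0 →
      ev.mapMatrix Q = L * Matrix.fromBlocks (c • S⁻¹) X12 0 ζ →
      IsUnit Q.det ∧ ∃ Y12, ev.mapMatrix Q⁻¹ = Matrix.fromBlocks (c⁻¹ • S) Y12 0 ζ⁻¹ * L' := by
    intro Q c hc X12 ζ hζ hQ
    have hζu : IsUnit ζ.det := isUnit_iff_ne_zero.mpr hζ
    have hu : IsUnit Q.det := by
      apply hinvU
      rw [hQ, Matrix.det_mul, hLdet, one_mul, Matrix.det_fromBlocks_zero₂₁, Matrix.det_smul]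
      refine mul_ne_zero (mul_ne_zero (pow_ne_zero _ hc) ?_) hζ
      exact (Matrix.isUnit_nonsing_inv_det _ hSu).ne_zero
    refine ⟨hu, -((c⁻¹ • S) * X12 * ζ⁻¹), ?_⟩
    apply einv _ hu
    have : Matrix.fromBlocks (c • S⁻¹) X12 0 ζ *
        Matrix.fromBlocks (c⁻¹ • S) (-((c⁻¹ • S) * X12 * ζ⁻¹)) 0 ζ⁻¹ = 1 := by
      rw [Matrix.fromBlocks_multiply]
      simp [Matrix.nonsing_inv_mul _ hSu, Matrix.mul_nonsing_inv _ hζu, ← Matrix.mul_assoc,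
        smul_smul, hc]
    rw [hQ, mul_assoc, ← mul_assoc _ _ L', this, one_mul, hLL']
  have hmulL : ∀ X Y, L' * X = Y → X = L * Y := by
    intro X Y h; rw [← h, ← mul_assoc, hLL', one_mul]
  obtain ⟨hWu, X12, hX⟩ := key W m hmC (-((m:ℂ) • (S⁻¹ * B * D⁻¹)) - (P12 + a12)) ζ1 hZ1 (by
    apply hmulL
    rw [hW, map_sub, es, map_mul _ _ E, map_add, map_add, map_mul, hP, ha, hU, hE0, hV0, map_natCast,
      mul_sub, Matrix.mul_smul, ← mul_assoc L' L, hL'L, one_mul, hL', hz1]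
    simp only [Matrix.fromBlocks_multiply, Matrix.fromBlocks_add, Matrix.fromBlocks_smul,
      fromBlocks_sub']
    congr 1 <;> simp [Matrix.mul_add]
    abel)
  have hβ1i : β1⁻¹ = φ.mapMatrix (E * W⁻¹) := by
    rw [hβ1, Matrix.mul_inv_rev, Matrix.nonsing_inv_nonsing_inv _ hEdet, φinv _ hWu, map_mul]
  set Y := ((m : R) + 1) • (E * W⁻¹ * E) - (m : R) • U⁻¹ + P * E with hY
  have hβ2' : β2 = ((m : K) + 1) • β1⁻¹ - (m : K) • (φ.mapMatrix (E * U))⁻¹ + φ.mapMatrix P := by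
    rw [h2]; nth_rewrite 2 [h1]; abel
  have hβ2 : β2 = φ.mapMatrix Y * Ek⁻¹ := by
    rw [hβ2', hβ1i, hβm, hY, map_add, map_sub, φs, φs, map_mul _ _ E, map_mul _ P E, add_mul,
      sub_mul, Matrix.smul_mul, mul_assoc _ _ Ek⁻¹, ← hEk, hEE, mul_one, mul_assoc _ _ Ek⁻¹, hEE,
      mul_one, map_add, map_natCast, map_one, Matrix.smul_mul]
  obtain ⟨hYu, Y12, hYi⟩ := key Y (-m) (neg_ne_zero.mpr hmC) ((m:ℂ) • (S⁻¹ * B * D⁻¹) + P12) ζ2 hZ2 (by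
    apply hmulL
    rw [hY, map_add, map_sub, es, es, map_mul _ _ E, map_mul, map_mul, hP, hX, hE0, hV0, map_add,
      map_one, map_natCast,
      mul_add, mul_sub, Matrix.mul_smul, Matrix.mul_smul, ← mul_assoc L' L, hL'L, one_mul, hL', hz2]
    simp only [Matrix.fromBlocks_multiply, Matrix.fromBlocks_add, Matrix.fromBlocks_smul,
      fromBlocks_sub']
    congr 1 <;> simp
    abel)
  have hβ2i : β2⁻¹ = φ.mapMatrix (E * Y⁻¹) := by
    rw [hβ2, Matrix.mul_inv_rev, Matrix.nonsing_inv_nonsing_inv _ hEdet, φinv _ hYu, map_mul]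
  refine ⟨((m : R) + 2) • Y⁻¹ - ((m : R) + 1) • W⁻¹ + U, ?_, ?_⟩
  · rw [h3]; nth_rewrite 2 [h2]
    rw [hβ2i, hβ1i, mul_add, mul_sub, Matrix.mul_smul, Matrix.mul_smul, map_add, map_sub, φs, φs]
    simp only [map_add, map_natCast, map_one, map_ofNat]
    abel
  · have hT : ev.mapMatrix (((m : R) + 2) • Y⁻¹ - ((m : R) + 1) • W⁻¹ + U) * L =
        Matrix.fromBlocks ((-((m:ℂ)+3)/m) • S)
          (((m:ℂ)+2) • Y12 - ((m:ℂ)+1) • X12 + B) 0 ζ3 := by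
      rw [map_add, map_sub, es, es, hX, hYi, add_mul, sub_mul, hUL, Matrix.smul_mul,
        Matrix.smul_mul, mul_assoc, hL'L, mul_one, mul_assoc, hL'L, mul_one, hz3]
      simp only [map_add, map_natCast, map_one, map_ofNat, Matrix.fromBlocks_add,
        Matrix.fromBlocks_smul, fromBlocks_sub']
      congr 1
      · ext i j
        simp
        field_simp
        ring
      · simp
      · abel
    have := congrArg Matrix.det hT
    rw [Matrix.det_mul, hLdet, mul_one, Matrix.det_fromBlocks_zero₂₁, ← RingHom.map_det,
      Matrix.det_smul] at this
    rw [this]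
    have h3 : (-((m:ℂ)+3)/m) ≠ 0 := by
      apply div_ne_zero _ hmC
      rw [neg_ne_zero]
      exact_mod_cast (by omega : m + 3 ≠ 0)
    have h4 := mul_ne_zero (pow_ne_zero (Fintype.card (Fin r)) h3) hSdet
    constructor
    · intro h; exact right_ne_zero_of_mul h
    · intro h; exact mul_ne_zero h4 h


lemma coeff_facts (r : ℕ) (t : PowerSeries ℂ) (x : LS)
    (hx : x = HahnSeries.ofPowerSeries ℤ ℂ (PowerSeries.X ^ r * t)) :
    (∀ j : ℤ, j < (r : ℤ) → x.coeff j = 0) ∧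
      x.coeff (r : ℤ) = PowerSeries.constantCoeff t := by
  subst hx
  constructor
  · intro j hj
    rw [PowerSeries.coeff_coe]
    split_ifs with h
    · rfl
    · rw [PowerSeries.coeff_X_pow_mul', if_neg (by omega)]
  · rw [HahnSeries.ofPowerSeries_apply_coeff, PowerSeries.coeff_X_pow_mul', if_pos le_rfl]
    simp

lemma order_facts (r : ℕ) (x : LS) (h : ∀ j : ℤ, j < (r : ℤ) → x.coeff j = 0) :
    (x ≠ 0 ∧ x.order = (r : ℤ)) ↔ x.coeff (r : ℤ) ≠ 0 := by
  constructor
  · rintro ⟨h0, ho⟩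
    rw [← ho]
    exact fun h1 => h0 (HahnSeries.coeff_order_eq_zero.mp h1)
  · intro hc
    have h0 : x ≠ 0 := by rintro rfl; simp at hc
    refine ⟨h0, le_antisymm (HahnSeries.order_le_of_coeff_ne_zero hc) ?_⟩
    by_contra hlt
    exact h0 (HahnSeries.coeff_order_eq_zero.mp (h _ (not_le.mp hlt)))

lemma det_E_mul {r s : ℕ} (T : Matrix (Idx r s) (Idx r s) (PowerSeries ℂ)) :
    ((HahnSeries.ofPowerSeries ℤ ℂ).mapMatrix
      (Matrix.fromBlocks ((PowerSeries.X : PowerSeries ℂ) • (1 : Matrix (Fin r) (Fin r) _)) 0 0 1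
        * T)).det = HahnSeries.ofPowerSeries ℤ ℂ (PowerSeries.X ^ r * T.det) := by
  rw [← RingHom.map_det, Matrix.det_mul, Matrix.det_fromBlocks_zero₂₁, Matrix.det_smul]
  simp

/-- lift of a matrix with shift `k i` in row `i`. -/
def shiftLift {r s : ℕ} (k : Idx r s → ℕ) (M : Matrix (Idx r s) (Idx r s) LS) :
    Matrix (Idx r s) (Idx r s) (PowerSeries ℂ) :=
  Matrix.of fun i j => PowerSeries.mk fun n => (M i j).coeff ((n : ℤ) + k i)

lemma lift_entry (f : LS) (k : ℕ) (h : ∀ j : ℤ, j < k → f.coeff j = 0) :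
    HahnSeries.ofPowerSeries ℤ ℂ (PowerSeries.X ^ k * PowerSeries.mk fun n => f.coeff ((n : ℤ) + k))
      = f := by
  ext j
  rw [PowerSeries.coeff_coe]
  split_ifs with hj
  · rw [h j (by omega)]
  · rw [PowerSeries.coeff_X_pow_mul']
    split_ifs with h2
    · rw [PowerSeries.coeff_mk]; congr 1; omega
    · rw [h j (by omega)]

end AbsLemma

/-- Theorem 2 (3) of the paper. Assume `β_{m−1} ∈ A`, `β_m ∈ A_𝔎`
with `ord(det β_m) = r`, `det D_{m,0} ≠ 0`, `det Z₁ ≠ 0` and `det Z₂ ≠ 0`, and define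
the dPI iterates `β_{m+1}, β_{m+2}, β_{m+3}`. Then `det β_{m+3} ≠ 0` with
`ord(det β_{m+3}) = r` iff `det Z₃ ≠ 0`; equivalently, the coefficient of `ε^j` in
`det β_{m+3}` vanishes for `j < r`, and the coefficient of `ε^r` is nonzero iff
`det Z₃ ≠ 0`. -/
theorem det_beta_m3_order_iff_Z3 (r s m : ℕ) (hr : 0 < r) (hs : 0 < s) (hm : 2 ≤ m)
    (α : Matrix (Idx r s) (Idx r s) ℂ)
    (βprev βm β1 β2 β3 : Matrix (Idx r s) (Idx r s) LS)
    (hprev : memA βprev) (hβm : memAK βm)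
    (hdm : βm.det ≠ 0 ∧ βm.det.order = (r : ℤ))
    (hD : (Dblk βm 0).det ≠ 0)
    (hZ1 : (Z1 m βprev βm α).det ≠ 0)
    (hZ2 : (Z2 m βprev βm α).det ≠ 0)
    (h1 : β1 = (m : LS) • βm⁻¹ - βprev - βm - constM α)
    (h2 : β2 = ((m : LS) + 1) • β1⁻¹ - βm - β1 - constM α)
    (h3 : β3 = ((m : LS) + 2) • β2⁻¹ - β1 - β2 - constM α) :
    ((β3.det ≠ 0 ∧ β3.det.order = (r : ℤ)) ↔ (Z3 m βprev βm α).det ≠ 0) ∧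
    (∀ j : ℤ, j < (r : ℤ) → β3.det.coeff j = 0) ∧
    (β3.det.coeff (r : ℤ) ≠ 0 ↔ (Z3 m βprev βm α).det ≠ 0) := by
  obtain ⟨hA, hK⟩ := hβm
  set φ := HahnSeries.ofPowerSeries ℤ ℂ with hφ
  set ev := (PowerSeries.constantCoeff : PowerSeries ℂ →+* ℂ) with hev
  set E : Matrix (Idx r s) (Idx r s) (PowerSeries ℂ) :=
    Matrix.fromBlocks ((PowerSeries.X : PowerSeries ℂ) • (1 : Matrix (Fin r) (Fin r) _)) 0 0 1
    with hE
  set U := shiftLift (Sum.elim (fun _ => 1) (fun _ => 0)) βm with hU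
  set P := shiftLift (fun _ => 0) βprev with hP
  have hPφ : φ.mapMatrix P = βprev := by
    ext1 i j
    have := lift_entry (βprev i j) 0 (fun k hk => hprev i j k (by simpa using hk))
    rw [pow_zero, one_mul] at this
    exact this
  have hUφ : φ.mapMatrix (E * U) = βm := by
    ext1 i j
    rw [← Matrix.fromBlocks_toBlocks U, hE, Matrix.fromBlocks_multiply]
    rcases i with i | i
    · have := lift_entry (βm (Sum.inl i) j) 1 (fun k hk => by
        rcases lt_or_eq_of_le (show k ≤ 0 by push_cast at hk; omega) with h | h
        · exact hA _ _ k h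
        · rw [h]; exact hK i j)
      rw [pow_one] at this
      rcases j with j | j <;> simpa [Matrix.toBlocks₁₁, Matrix.toBlocks₁₂, hU, shiftLift, hφ] using this
    · have := lift_entry (βm (Sum.inr i) j) 0 (fun k hk => hA _ _ k (by simpa using hk))
      rw [pow_zero, one_mul] at this
      rcases j with j | j <;> simpa [Matrix.toBlocks₂₁, Matrix.toBlocks₂₂, hU, shiftLift] using this
  set a : Matrix (Idx r s) (Idx r s) (PowerSeries ℂ) := α.map PowerSeries.C with ha
  have haφ : φ.mapMatrix a = constM α := by
    ext1 i j
    simp only [ha, constM, RingHom.mapMatrix_apply, Matrix.map_apply, hφ]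
    first
    | exact (HahnSeries.algebraMap_apply' ℤ (α i j)).symm
    | rw [HahnSeries.ofPowerSeries_C, HahnSeries.algebraMap_apply]; simp
  have hae : ev.mapMatrix a = α := by
    ext i j; simp [ha, hev]
  have hPe : ev.mapMatrix P = coeffM βprev 0 := by
    ext i j
    simp [hP, hev, shiftLift, coeffM, ← PowerSeries.coeff_zero_eq_constantCoeff_apply]
  have hC : (ev.mapMatrix U).toBlocks₂₁ = Cblk βm 0 := by
    ext i j
    simp [hU, hev, shiftLift, coeffM, Cblk, Matrix.toBlocks₂₁,
      ← PowerSeries.coeff_zero_eq_constantCoeff_apply]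
  have hDD : (ev.mapMatrix U).toBlocks₂₂ = Dblk βm 0 := by
    ext i j
    simp [hU, hev, shiftLift, coeffM, Dblk, Matrix.toBlocks₂₂,
      ← PowerSeries.coeff_zero_eq_constantCoeff_apply]
  have hdet : ev U.det ≠ 0 := by
    have hx : βm.det = φ (PowerSeries.X ^ r * U.det) := by
      rw [← hUφ]; exact det_E_mul U
    obtain ⟨c1, c2⟩ := coeff_facts r U.det _ hx
    rw [← c2]
    exact (order_facts r _ c1).mp hdm
  obtain ⟨T, hT, hTZ⟩ := abs_core φ ev
    (fun x hx => PowerSeries.isUnit_iff_constantCoeff.mpr (isUnit_iff_ne_zero.mpr hx))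
    PowerSeries.X (by simp [hφ]) (by simp [hev]) m hm U P a E hE
    _ _ _ _ (Matrix.fromBlocks_toBlocks _).symm hdet (by rw [hDD]; exact hD)
    _ _ _ _ (Matrix.fromBlocks_toBlocks _).symm
    _ _ _ _ (Matrix.fromBlocks_toBlocks _).symm
    (Z1 m βprev βm α) (Z2 m βprev βm α) (Z3 m βprev βm α)
    (by rw [hDD, hC, hPe, hae]; rfl) (by rw [hDD, hC, hPe]; rfl) (by rw [hDD]; rfl)
    hZ1 hZ2 β1 β2 β3 (by rw [hUφ, hPφ, haφ]; exact h1) (by rw [hUφ, haφ]; exact h2)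
    (by rw [haφ]; exact h3)
  have hx : β3.det = φ (PowerSeries.X ^ r * T.det) := by
    rw [hT]; exact det_E_mul T
  obtain ⟨c1, c2⟩ := coeff_facts r T.det _ hx
  rw [order_facts r _ c1, c2]
  exact ⟨hTZ, c1, hTZ⟩
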